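/- arXiv:2301.11678 — 3 statements merged into one kernel-verified Lean document; each statement's English description precedes it below -/
import Mathlib

section
/- Let n, p ≥ 1, let C• and C̃ be symmetric p-tensors on ℝ^n, let W ∈ ℝ^{n×n} be nonsingular, let s ∈ ℝ^n be nonzero, and set v = W^{-T}W^{-1}s. Then the unique symmetric p-tensor C+ minimizing ‖(C − C•)[W]^p‖_F over all symmetric p-tensors C satisfying C[s] = C̃[s] is given explicitly by C+ = C• + Σ_{j=1}^p (−1)^{j+1} binom(p,j) (v^T s)^{−j} P_sym((⊗^j v) ⊗ (C̃ − C•)[s]^j). -/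
open scoped BigOperators
open Matrix Filter

noncomputable section

/-- A `q`-tensor on `ℝ^n` (a multilinear map `(ℝ^n)^q → ℝ`), represented by its
coefficient array on the standard basis. -/
abbrev Tensor (n q : ℕ) := (Fin q → Fin n) → ℝ

namespace Tensor

/-- Evaluation of a tensor (as a multilinear map) on the vectors `u 0, …, u (q-1)`. -/
def eval {n q : ℕ} (T : Tensor n q) (u : Fin q → (Fin n → ℝ)) : ℝ :=
  ∑ i : Fin q → Fin n, T i * ∏ k, u k (i k)

/-- A tensor is symmetric if it is invariant under all permutations of its arguments. -/
def Symm {n q : ℕ} (T : Tensor n q) : Prop :=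
  ∀ σ : Equiv.Perm (Fin q), ∀ i : Fin q → Fin n, T (i ∘ σ) = T i

/-- The Frobenius norm of a tensor: the Euclidean norm of its coefficient array. -/
def frobNorm {n q : ℕ} (T : Tensor n q) : ℝ :=
  Real.sqrt (∑ i : Fin q → Fin n, (T i) ^ 2)

/-- The Frobenius inner product of two tensors. -/
def finner {n q : ℕ} (T S : Tensor n q) : ℝ := ∑ i : Fin q → Fin n, T i * S i

/-- The symmetric projection `P_sym(T) = (1/q!) ∑_σ σ(T)`. -/
def psym {n q : ℕ} (T : Tensor n q) : Tensor n q :=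
  fun i => ((Nat.factorial q : ℝ))⁻¹ * ∑ σ : Equiv.Perm (Fin q), T (i ∘ σ)

/-- `T[W]^q`: apply the matrix `W` to every argument of `T`. -/
def applyMat {n q : ℕ} (T : Tensor n q) (W : Matrix (Fin n) (Fin n) ℝ) : Tensor n q :=
  fun j => ∑ i : Fin q → Fin n, T i * ∏ k, W (i k) (j k)

/-- `T[v]^j`: fix the first `j` arguments of `T` to the vector `v`,
yielding a `(q-j)`-tensor. -/
def fixMany {n q : ℕ} (T : Tensor n q) (v : Fin n → ℝ) (j : ℕ) : Tensor n (q - j) :=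
  fun idx => ∑ i : Fin j → Fin n, (∏ k, v (i k)) *
    T (fun k => if h : (k : ℕ) < j then i ⟨k, h⟩
        else idx ⟨(k : ℕ) - j, by have hk := k.isLt; omega⟩)

/-- The outer product of two tensors. -/
def outer {n a b : ℕ} (T : Tensor n a) (S : Tensor n b) : Tensor n (a + b) :=
  fun idx => T (fun k => idx (Fin.castAdd b k)) * S (fun k => idx (Fin.natAdd a k))

/-- Reindexing a tensor along an equality of orders. -/
def castOrder {n a b : ℕ} (h : a = b) (T : Tensor n a) : Tensor n b :=
  fun idx => T (fun k => idx (Fin.cast h k))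

/-- Apply a matrix to the first argument of a tensor only. -/
def applyFirst {n q : ℕ} (hq : 0 < q) (T : Tensor n q) (M : Matrix (Fin n) (Fin n) ℝ) :
    Tensor n q :=
  fun idx => ∑ i : Fin n, M i (idx ⟨0, hq⟩) * T (Function.update idx ⟨0, hq⟩ i)

end Tensor

/-- `⊗^j v`, the `j`-fold outer product of a vector `v` with itself. -/
def vpow {n : ℕ} (j : ℕ) (v : Fin n → ℝ) : Tensor n j := fun idx => ∏ k, v (idx k)

/-- The Euclidean (2-) norm of a vector in `ℝ^n`. -/
def vnorm {n : ℕ} (v : Fin n → ℝ) : ℝ := Real.sqrt (∑ i, v i ^ 2)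

/-- The injective (2-) norm of a tensor:
the supremum of `|T[u_1,…,u_q]|` over unit vectors. -/
def Tensor.inj2Norm {n q : ℕ} (T : Tensor n q) : ℝ :=
  sSup ((fun u => |T.eval u|) '' {u : Fin q → Fin n → ℝ | ∀ k, vnorm (u k) = 1})

/-- The spectral (operator 2-) norm of a matrix. -/
def specNorm {n : ℕ} (M : Matrix (Fin n) (Fin n) ℝ) : ℝ :=
  ‖Matrix.toEuclideanCLM (𝕜 := ℝ) M‖

/-- The orthogonal projection `I - w wᵀ / (wᵀ w)` onto the orthogonal complement of `w`. -/
def projPerp {n : ℕ} (w : Fin n → ℝ) : Matrix (Fin n) (Fin n) ℝ :=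
  1 - (w ⬝ᵥ w)⁻¹ • Matrix.vecMulVec w w

/-- `Cp` is a least-change symmetric update of `Cb` in the `W`-weighted Frobenius norm,
subject to the secant equation `Cp[s] = R`. -/
def IsSecantUpdate {n p : ℕ} (Cb : Tensor n p) (R : Tensor n (p - 1))
    (W : Matrix (Fin n) (Fin n) ℝ) (s : Fin n → ℝ) (Cp : Tensor n p) : Prop :=
  Cp.Symm ∧ Cp.fixMany s 1 = R ∧
    ∀ C : Tensor n p, C.Symm → C.fixMany s 1 = R →
      ((Cp - Cb).applyMat W).frobNorm ≤ ((C - Cb).applyMat W).frobNorm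

/-- The explicit higher-order secant update formula of Theorem 1 (b):
`C• + ∑_{j=1}^p (-1)^{j+1} C(p,j) (vᵀs)^{-j} P_sym((⊗^j v) ⊗ (C̃ - C•)[s]^j)`. -/
def hosuFormula {n p : ℕ} (Cb Ct : Tensor n p) (v s : Fin n → ℝ) : Tensor n p :=
  Cb + ∑ j ∈ (Finset.Icc 1 p).attach,
    ((-1 : ℝ) ^ ((j : ℕ) + 1) * (p.choose (j : ℕ) : ℝ) * ((v ⬝ᵥ s) ^ (j : ℕ))⁻¹) •
      Tensor.castOrder (Nat.add_sub_cancel' (Finset.mem_Icc.mp j.2).2)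
        (Tensor.psym ((vpow (j : ℕ) v).outer ((Ct - Cb).fixMany s (j : ℕ))))

/-- The coefficient array of the `q`-th derivative of `f : ℝ^n → ℝ`
(domain given the sup-norm product structure). -/
def derivTensorPi {n : ℕ} (q : ℕ) (f : (Fin n → ℝ) → ℝ) (x : Fin n → ℝ) : Tensor n q :=
  fun idx => iteratedFDeriv ℝ q f x (fun k => Pi.single (idx k) 1)

/-- The coefficient array of the `q`-th derivative of `f : ℝ^n → ℝ`
(domain given the Euclidean structure). -/
def derivTensorE {n : ℕ} (q : ℕ) (f : EuclideanSpace ℝ (Fin n) → ℝ)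
    (x : EuclideanSpace ℝ (Fin n)) : Tensor n q :=
  fun idx => iteratedFDeriv ℝ q f x (fun k => EuclideanSpace.single (idx k) 1)

/-- Reinterpret a Euclidean vector as a plain vector in `Fin n → ℝ`. -/
def toVec {n : ℕ} (y : EuclideanSpace ℝ (Fin n)) : Fin n → ℝ := y

namespace Tensor

variable {n q : ℕ}

theorem Symm.sub {T S : Tensor n q} (hT : T.Symm) (hS : S.Symm) : (T - S).Symm := by
  intro σ i
  simp [hT σ i, hS σ i]

theorem Symm.add {T S : Tensor n q} (hT : T.Symm) (hS : S.Symm) : (T + S).Symm := by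
  intro σ i
  simp [hT σ i, hS σ i]

theorem Symm.applyMat {T : Tensor n q} (hT : T.Symm) (A : Matrix (Fin n) (Fin n) ℝ) :
    (T.applyMat A).Symm := by
  intro σ j
  simp only [Tensor.applyMat]
  rw [← Equiv.sum_comp (Equiv.arrowCongr σ.symm (Equiv.refl (Fin n)))]
  refine Finset.sum_congr rfl fun i _ => ?_
  have h : Equiv.arrowCongr σ.symm (Equiv.refl (Fin n)) i = i ∘ σ := by
    ext k; simp [Equiv.arrowCongr]
  rw [h, hT σ i]
  congr 1
  exact Equiv.prod_comp σ fun k => A (i k) (j k)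

theorem applyMat_sub (T S : Tensor n q) (A : Matrix (Fin n) (Fin n) ℝ) :
    (T - S).applyMat A = T.applyMat A - S.applyMat A := by
  ext j
  simp [applyMat, sub_mul, Finset.sum_sub_distrib]

theorem applyMat_add (T S : Tensor n q) (A : Matrix (Fin n) (Fin n) ℝ) :
    (T + S).applyMat A = T.applyMat A + S.applyMat A := by
  ext j
  simp [applyMat, add_mul, Finset.sum_add_distrib]

theorem applyMat_mul (T : Tensor n q) (A B : Matrix (Fin n) (Fin n) ℝ) :
    T.applyMat (A * B) = (T.applyMat A).applyMat B := by
  ext j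
  simp only [applyMat, Matrix.mul_apply, Finset.prod_univ_sum, Fintype.piFinset_univ,
    Finset.sum_mul, Finset.mul_sum]
  rw [Finset.sum_comm]
  refine Finset.sum_congr rfl fun i _ => Finset.sum_congr rfl fun l _ => ?_
  rw [Finset.prod_mul_distrib, mul_assoc]

theorem applyMat_one (T : Tensor n q) : T.applyMat 1 = T := by
  ext j
  simp only [applyMat, Matrix.one_apply, Finset.prod_ite_zero, Finset.prod_const_one]
  rw [Finset.sum_eq_single j]
  · simp
  · intro i _ hij
    rw [if_neg, mul_zero]
    exact fun h => hij (funext fun k => h k (Finset.mem_univ k))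
  · simp

theorem finner_applyMat_left (T S : Tensor n q) (A : Matrix (Fin n) (Fin n) ℝ) :
    (T.applyMat A).finner S = T.finner (S.applyMat Aᵀ) := by
  simp only [finner, applyMat, Finset.sum_mul, Finset.mul_sum, Matrix.transpose_apply]
  rw [Finset.sum_comm]
  refine Finset.sum_congr rfl fun i _ => Finset.sum_congr rfl fun l _ => ?_
  ring

theorem finner_sub_left (T S R : Tensor n q) :
    (T - S).finner R = T.finner R - S.finner R := by
  simp [finner, sub_mul, Finset.sum_sub_distrib]

theorem fixMany_sub (T S : Tensor n q) (s : Fin n → ℝ) (j : ℕ) :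
    (T - S).fixMany s j = T.fixMany s j - S.fixMany s j := by
  ext idx
  simp [fixMany, mul_sub, Finset.sum_sub_distrib]

theorem fixMany_add (T S : Tensor n q) (s : Fin n → ℝ) (j : ℕ) :
    (T + S).fixMany s j = T.fixMany s j + S.fixMany s j := by
  ext idx
  simp [fixMany, mul_add, Finset.sum_add_distrib]

theorem fixMany_one (T : Tensor n (q + 1)) (s : Fin n → ℝ) (idx : Fin q → Fin n) :
    T.fixMany s 1 idx = ∑ x, s x * T (Fin.cons x idx : Fin (q + 1) → Fin n) := by
  simp only [fixMany]
  rw [← Equiv.sum_comp (Equiv.funUnique (Fin 1) (Fin n)).symm]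
  refine Finset.sum_congr rfl fun x _ => ?_
  simp only [Finset.univ_unique, Finset.prod_singleton]
  congr 2
  ext k
  refine Fin.cases ?_ (fun k => ?_) k
  · simp [Equiv.funUnique]
  · simp

theorem Symm.apply_insertNth {T : Tensor n (q + 1)} (hT : T.Symm) (k : Fin (q + 1))
    (x : Fin n) (i : Fin q → Fin n) :
    T (k.insertNth (α := fun _ => Fin n) x i) = T (Fin.cons x i : Fin (q + 1) → Fin n) := by
  rw [← hT k.cycleRange.symm, Fin.insertNth_comp_cycleRange_symm]

theorem applyMat_fixMany_one (T : Tensor n (q + 1)) (A : Matrix (Fin n) (Fin n) ℝ)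
    (s : Fin n → ℝ) (h : A *ᵥ s = 0) : (T.applyMat A).fixMany s 1 = 0 := by
  ext idx
  rw [fixMany_one]
  simp only [applyMat, Fin.prod_univ_succ, Fin.cons_zero, Fin.cons_succ, Finset.mul_sum]
  rw [Finset.sum_comm]
  refine Finset.sum_eq_zero fun i _ => ?_
  have hi := congrFun h (i 0)
  simp only [Matrix.mulVec, dotProduct, Pi.zero_apply] at hi
  calc _ = T i * (∑ x, A (i 0) x * s x) * ∏ k : Fin q, A (i k.succ) (idx k) := by
        rw [Finset.mul_sum, Finset.sum_mul]
        refine Finset.sum_congr rfl fun x _ => ?_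
        ring
    _ = 0 := by rw [hi]; ring

/-- The sum of two squared norms is the squared norm of the sum for orthogonal tensors. -/
theorem frobNorm_add_sq (T S : Tensor n q) (h : T.finner S = 0) :
    (T + S).frobNorm ^ 2 = T.frobNorm ^ 2 + S.frobNorm ^ 2 := by
  simp only [frobNorm]
  rw [Real.sq_sqrt (by positivity), Real.sq_sqrt (by positivity), Real.sq_sqrt (by positivity)]
  have h2 : ∑ i, (T + S) i ^ 2 = ∑ i, T i ^ 2 + ∑ i, S i ^ 2 + 2 * T.finner S := by
    simp only [finner, Finset.mul_sum, ← Finset.sum_add_distrib, Pi.add_apply]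
    refine Finset.sum_congr rfl fun i _ => ?_
    ring
  rw [h2, h]; ring

theorem eq_zero_of_frobNorm_eq_zero {T : Tensor n q} (h : T.frobNorm = 0) : T = 0 := by
  rw [frobNorm, Real.sqrt_eq_zero (by positivity),
    Finset.sum_eq_zero_iff_of_nonneg fun i _ => sq_nonneg _] at h
  ext i
  simpa using h i (Finset.mem_univ i)

/-- `T` with the arguments in `A` fixed to `s`, multiplied by the values of `v` at these
arguments. -/
def contractOn (T : Tensor n q) (s v : Fin n → ℝ) (A : Finset (Fin q)) : Tensor n q :=
  fun j => ∑ i : Fin q → Fin n, T i * ((∏ k ∈ A, s (i k) * v (j k)) *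
    ∏ k ∈ Aᶜ, if i k = j k then 1 else 0)

theorem contractOn_empty (T : Tensor n q) (s v : Fin n → ℝ) : T.contractOn s v ∅ = T := by
  conv_rhs => rw [← applyMat_one T]
  ext j
  simp [contractOn, applyMat, Matrix.one_apply]

theorem applyMat_one_sub_smul_vecMulVec (T : Tensor n q) (s v : Fin n → ℝ) (c : ℝ)
    (j : Fin q → Fin n) :
    T.applyMat (1 - c • Matrix.vecMulVec s v) j =
      ∑ A : Finset (Fin q), (-c) ^ A.card * T.contractOn s v A j := by
  simp only [applyMat, contractOn, Finset.mul_sum]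
  rw [Finset.sum_comm]
  refine Finset.sum_congr rfl fun i _ => ?_
  have h : ∀ k, (1 - c • Matrix.vecMulVec s v) (i k) (j k) =
      (-c) * (s (i k) * v (j k)) + if i k = j k then 1 else 0 := by
    intro k
    simp [Matrix.one_apply, Matrix.vecMulVec_apply]
    ring
  simp only [h, Finset.prod_add, Finset.powerset_univ, Finset.mul_sum,
    ← Finset.compl_eq_univ_sdiff, Finset.prod_mul_distrib (f := fun _ => -c),
    Finset.prod_const]
  refine Finset.sum_congr rfl fun A _ => ?_
  ring

theorem Symm.contractOn_eq_zero {T : Tensor n (q + 1)} (hT : T.Symm) {s : Fin n → ℝ}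
    (h : T.fixMany s 1 = 0) (v : Fin n → ℝ) {A : Finset (Fin (q + 1))} (hA : A.Nonempty) :
    T.contractOn s v A = 0 := by
  obtain ⟨k, hk⟩ := hA
  ext j
  simp only [contractOn]
  rw [← Equiv.sum_comp (Fin.insertNthEquiv (fun _ => Fin n) k), Fintype.sum_prod_type,
    Finset.sum_comm]
  refine Finset.sum_eq_zero fun i _ => ?_
  have hi := congrFun h i
  rw [fixMany_one] at hi
  have hA' : ∀ x, ∏ l ∈ A.erase k, s (k.insertNth (α := fun _ => Fin n) x i l) * v (j l) =
      ∏ l ∈ A.erase k, s (k.insertNth (α := fun _ => Fin n) (j k) i l) * v (j l) := by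
    intro x
    refine Finset.prod_congr rfl fun l hl => ?_
    obtain ⟨m, rfl⟩ := Fin.exists_succAbove_eq (Finset.ne_of_mem_erase hl)
    simp
  have hB' : ∀ x, (∏ l ∈ Aᶜ, if k.insertNth (α := fun _ => Fin n) x i l = j l then (1 : ℝ) else 0) =
      ∏ l ∈ Aᶜ, if k.insertNth (α := fun _ => Fin n) (j k) i l = j l then (1 : ℝ) else 0 := by
    intro x
    refine Finset.prod_congr rfl fun l hl => ?_
    have hlk : l ≠ k := by rintro rfl; simp [hk] at hl
    obtain ⟨m, rfl⟩ := Fin.exists_succAbove_eq hlk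
    simp
  have hT' : ∀ x, T (Fin.insertNthEquiv (fun _ => Fin n) k (x, i)) =
      T (Fin.cons x i : Fin (q + 1) → Fin n) := fun x => hT.apply_insertNth k x i
  simp only [hT', Fin.insertNthEquiv_apply, ← Finset.mul_prod_erase A _ hk, hA', hB',
    Fin.insertNth_apply_same]
  rw [Pi.zero_apply] at hi
  refine Eq.trans ?_ (mul_eq_zero_of_left hi (v (j k) *
    (∏ l ∈ A.erase k, s (k.insertNth (α := fun _ => Fin n) (j k) i l) * v (j l)) *
    ∏ l ∈ Aᶜ, if k.insertNth (α := fun _ => Fin n) (j k) i l = j l then (1 : ℝ) else 0))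
  rw [Finset.sum_mul]
  refine Finset.sum_congr rfl fun x _ => ?_
  ring

theorem Symm.applyMat_eq_self {T : Tensor n (q + 1)} (hT : T.Symm) {s : Fin n → ℝ}
    (h : T.fixMany s 1 = 0) (v : Fin n → ℝ) (c : ℝ) :
    T.applyMat (1 - c • Matrix.vecMulVec s v) = T := by
  ext j
  rw [applyMat_one_sub_smul_vecMulVec, Finset.sum_eq_single ∅]
  · simp [contractOn_empty]
  · intro A _ hA
    rw [hT.contractOn_eq_zero h v (Finset.nonempty_iff_ne_empty.mpr hA)]
    simp
  · simp

theorem Symm.contractOn_comp {T : Tensor n q} (hT : T.Symm) (s v : Fin n → ℝ)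
    (A : Finset (Fin q)) (σ : Equiv.Perm (Fin q)) (j : Fin q → Fin n) :
    T.contractOn s v A (j ∘ σ) = T.contractOn s v (A.map σ.toEmbedding) j := by
  simp only [contractOn]
  rw [← Equiv.sum_comp (Equiv.arrowCongr σ.symm (Equiv.refl (Fin n)))]
  refine Finset.sum_congr rfl fun i _ => ?_
  have h : Equiv.arrowCongr σ.symm (Equiv.refl (Fin n)) i = i ∘ σ := by
    ext k; simp [Equiv.arrowCongr]
  have hc : (A.map σ.toEmbedding)ᶜ = Aᶜ.map σ.toEmbedding := by
    ext k; simp [Finset.mem_map_equiv]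
  rw [h, hT σ i, hc, Finset.prod_map, Finset.prod_map]
  rfl

/-- Averaging over all permutations agrees with averaging over all subsets of the same size. -/
theorem _root_.Finset.card_mul_sum_perm_map {α : Type*} [Fintype α] [DecidableEq α]
    (f : Finset α → ℝ) (A : Finset α) :
    ((Fintype.card α).choose A.card : ℝ) *
        ∑ σ : Equiv.Perm α, f (A.map σ.toEmbedding) =
      (Fintype.card α).factorial * ∑ B ∈ Finset.univ.powersetCard A.card, f B := by
  have h1 : ∀ B ∈ Finset.univ.powersetCard A.card,
      ∑ σ : Equiv.Perm α, f (B.map σ.toEmbedding) =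
        ∑ σ : Equiv.Perm α, f (A.map σ.toEmbedding) := by
    intro B hB
    obtain ⟨-, hB⟩ := Finset.mem_powersetCard.mp hB
    obtain ⟨ρ, rfl⟩ : ∃ ρ : Equiv.Perm α, A.map ρ.toEmbedding = B := by
      let e : {x // x ∈ A} ≃ {x // x ∈ B} := Finset.equivOfCardEq hB.symm
      refine ⟨e.extendSubtype, Finset.eq_of_subset_of_card_le ?_ (by simp [hB])⟩
      intro x hx
      obtain ⟨y, hy, rfl⟩ := Finset.mem_map.mp hx
      exact e.extendSubtype_mem y hy
    rw [← Equiv.sum_comp (Equiv.mulRight ρ) fun σ => f (A.map σ.toEmbedding)]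
    refine Finset.sum_congr rfl fun σ _ => ?_
    rw [Finset.map_map]
    rfl
  have h2 : ∀ σ : Equiv.Perm α, ∑ B ∈ Finset.univ.powersetCard A.card, f (B.map σ.toEmbedding) =
      ∑ B ∈ Finset.univ.powersetCard A.card, f B := by
    intro σ
    refine Finset.sum_equiv σ.finsetCongr ?_ ?_
    · intro B; simp [Finset.mem_powersetCard]
    · intro B _; rfl
  have h3 := Finset.sum_congr rfl h1
  rw [Finset.sum_comm, Finset.sum_congr rfl fun σ _ => h2 σ] at h3
  simpa [Fintype.card_perm] using h3.symm

/-- `⊗^m v ⊗ T[s]^m` is the contraction over the first `m` arguments. -/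
theorem castOrder_outer_vpow_fixMany {m : ℕ} (hm : m ≤ q) (h : m + (q - m) = q)
    (T : Tensor n q) (s v : Fin n → ℝ) :
    castOrder h ((vpow m v).outer (T.fixMany s m)) =
      T.contractOn s v (Finset.univ.map (Fin.castLEEmb hm)) := by
  ext j
  let glue : (Fin m → Fin n) → (Fin q → Fin n) :=
    fun i k => if hk : (k : ℕ) < m then i ⟨k, hk⟩ else j k
  have hglue : ∀ i k, glue i (Fin.castLE hm k) = i k := by
    intro i k; simp [glue]
  have hmem : ∀ k : Fin q, k ∈ (Finset.univ.map (Fin.castLEEmb hm))ᶜ ↔ ¬ (k : ℕ) < m := by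
    intro k
    simp only [Finset.mem_compl, Finset.mem_map, Finset.mem_univ, true_and, not_iff_not]
    constructor
    · rintro ⟨l, rfl⟩; simp
    · intro hk; exact ⟨⟨k, hk⟩, rfl⟩
  simp only [castOrder, outer, vpow, fixMany, contractOn, Finset.mul_sum]
  refine Fintype.sum_of_injective glue ?_ _ _ ?_ ?_
  · intro i i' hi
    ext k
    rw [← hglue i k, hi, hglue]
  · intro i hi
    by_contra hne
    refine hi ⟨fun k => i (Fin.castLE hm k), ?_⟩
    ext k
    simp only [glue]
    split_ifs with hk
    · rfl
    · have h0 := right_ne_zero_of_mul (right_ne_zero_of_mul hne)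
      rw [Finset.prod_ne_zero_iff] at h0
      have := h0 k ((hmem k).mpr hk)
      simp only [ne_eq, ite_eq_right_iff, one_ne_zero, imp_false, not_not] at this
      rw [this]
  · intro i
    have h1 : (∏ k ∈ (Finset.univ.map (Fin.castLEEmb hm))ᶜ,
        if glue i k = j k then (1 : ℝ) else 0) = 1 := by
      refine Finset.prod_eq_one fun k hk => ?_
      rw [hmem] at hk
      simp [glue, hk]
    rw [h1, Finset.prod_map, mul_one, Finset.prod_mul_distrib]
    have h2 : (fun k : Fin q => if hk : (k : ℕ) < m then i ⟨k, hk⟩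
        else j (Fin.cast h (Fin.natAdd m ⟨(k : ℕ) - m, by omega⟩))) = glue i := by
      ext k
      simp only [glue]
      split_ifs with hk
      · rfl
      · congr 2
        ext
        simp
        omega
    rw [h2]
    simp only [Fin.castLEEmb_apply, hglue]
    have h3 : ∀ k : Fin m, Fin.cast h (Fin.castAdd (q - m) k) = Fin.castLE hm k := fun k => rfl
    simp only [h3]
    ring

theorem castOrder_psym {a b : ℕ} (h : a = b) (T : Tensor n a) :
    castOrder h T.psym = (castOrder h T).psym := by
  subst h
  rfl

theorem Symm.choose_mul_psym {T : Tensor n q} (hT : T.Symm) {m : ℕ} (hm : m ≤ q)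
    (h : m + (q - m) = q) (s v : Fin n → ℝ) (j : Fin q → Fin n) :
    (q.choose m : ℝ) * castOrder h ((vpow m v).outer (T.fixMany s m)).psym j =
      ∑ A ∈ Finset.univ.powersetCard m, T.contractOn s v A j := by
  have key := Finset.card_mul_sum_perm_map (fun A => T.contractOn s v A j)
    (Finset.univ.map (Fin.castLEEmb hm))
  simp only [Fintype.card_fin, Finset.card_map, Finset.card_univ] at key
  rw [castOrder_psym, castOrder_outer_vpow_fixMany hm, psym]
  simp only [hT.contractOn_comp]
  rw [mul_left_comm, key, inv_mul_cancel_left₀]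
  exact_mod_cast q.factorial_ne_zero

end Tensor

/-- The higher-order secant update in closed form. -/
theorem hosuFormula_eq {n p : ℕ} {Cb Ct : Tensor n p} (hD : (Ct - Cb).Symm)
    (v s : Fin n → ℝ) :
    hosuFormula Cb Ct v s =
      Cb + ((Ct - Cb) - (Ct - Cb).applyMat (1 - (v ⬝ᵥ s)⁻¹ • Matrix.vecMulVec s v)) := by
  unfold hosuFormula
  congr 1
  ext j
  rw [Finset.sum_apply, Pi.sub_apply, Tensor.applyMat_one_sub_smul_vecMulVec]
  generalize Ct - Cb = D at *
  generalize v ⬝ᵥ s = a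
  have h : ∀ m ∈ (Finset.Icc 1 p).attach,
      (((-1 : ℝ) ^ ((m : ℕ) + 1) * (p.choose (m : ℕ) : ℝ) * (a ^ (m : ℕ))⁻¹) •
        Tensor.castOrder (Nat.add_sub_cancel' (Finset.mem_Icc.mp m.2).2)
          (Tensor.psym ((vpow (m : ℕ) v).outer (D.fixMany s (m : ℕ))))) j =
      (fun m : ℕ => -∑ A ∈ Finset.univ.powersetCard m, (-a⁻¹) ^ A.card * D.contractOn s v A j) m := by
    rintro ⟨m, hm⟩ -
    have hm' := (Finset.mem_Icc.mp hm).2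
    have hc : ∀ A ∈ (Finset.univ : Finset (Fin p)).powersetCard m,
        (-a⁻¹) ^ A.card * D.contractOn s v A j = (-a⁻¹) ^ m * D.contractOn s v A j := by
      intro A hA
      rw [(Finset.mem_powersetCard.mp hA).2]
    simp only
    rw [Finset.sum_congr rfl hc, ← Finset.mul_sum,
      ← hD.choose_mul_psym hm' (Nat.add_sub_cancel' hm') s v j, Pi.smul_apply, smul_eq_mul,
      neg_pow a⁻¹, inv_pow]
    ring
  rw [Finset.sum_congr rfl h, Finset.sum_attach (Finset.Icc 1 p)
    (fun m : ℕ => -∑ A ∈ Finset.univ.powersetCard m, (-a⁻¹) ^ A.card * D.contractOn s v A j),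
    ← Finset.powerset_univ, Finset.sum_powerset, Finset.card_univ, Fintype.card_fin,
    Finset.sum_range_succ', Finset.sum_neg_distrib, Finset.range_eq_Ico,
    Finset.sum_Ico_add' (fun m : ℕ => ∑ A ∈ Finset.univ.powersetCard m,
      (-a⁻¹) ^ A.card * D.contractOn s v A j) 0 p 1]
  simp [Tensor.contractOn_empty]
  rfl

/-- the unique least-change symmetric update in the `W`-weighted Frobenius
norm is given by the explicit formula with `v = W⁻ᵀW⁻¹s`. -/
theorem statement1 (n p : ℕ) (hn : 1 ≤ n) (hp : 1 ≤ p)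
    (Cb Ct : Tensor n p) (hCb : Cb.Symm) (hCt : Ct.Symm)
    (W : Matrix (Fin n) (Fin n) ℝ) (hW : IsUnit W.det)
    (s : Fin n → ℝ) (hs : s ≠ 0) :
    IsSecantUpdate Cb (Ct.fixMany s 1) W s
        (hosuFormula Cb Ct ((W⁻¹)ᵀ *ᵥ (W⁻¹ *ᵥ s)) s) ∧
      ∀ Cp : Tensor n p, IsSecantUpdate Cb (Ct.fixMany s 1) W s Cp →
        Cp = hosuFormula Cb Ct ((W⁻¹)ᵀ *ᵥ (W⁻¹ *ᵥ s)) s := by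
  obtain ⟨p, rfl⟩ : ∃ q, p = q + 1 := ⟨p - 1, by omega⟩
  have hWW : W * W⁻¹ = 1 := Matrix.mul_nonsing_inv W hW
  have hD := hCt.sub hCb
  set u := W⁻¹ *ᵥ s with hu
  set v := (W⁻¹)ᵀ *ᵥ u with hv
  have hWu : W *ᵥ u = s := by rw [hu, Matrix.mulVec_mulVec, hWW, Matrix.one_mulVec]
  have hvW : v ᵥ* W = u := by
    rw [hv, Matrix.mulVec_transpose, Matrix.vecMul_vecMul, Matrix.nonsing_inv_mul W hW,
      Matrix.vecMul_one]
  have ha : v ⬝ᵥ s ≠ 0 := by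
    rw [← hWu, Matrix.dotProduct_mulVec, hvW]
    intro h0
    rw [dotProduct_self_eq_zero] at h0
    exact hs (by rw [← hWu, h0, Matrix.mulVec_zero])
  rw [hosuFormula_eq hD]
  set c := (v ⬝ᵥ s)⁻¹ with hc
  set Q := 1 - c • Matrix.vecMulVec s v with hQ
  set X := (Ct - Cb) - (Ct - Cb).applyMat Q with hX
  set P := 1 - c • Matrix.vecMulVec u u with hP
  have hQs : Q *ᵥ s = 0 := by
    rw [hQ, Matrix.sub_mulVec, Matrix.one_mulVec, Matrix.smul_mulVec, Matrix.vecMulVec_mulVec]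
    ext i
    simp [hc]
    field_simp
    simp
  have hQW : Q * W = W * P := by
    rw [hQ, hP, Matrix.sub_mul, Matrix.mul_sub, Matrix.smul_mul, Matrix.mul_smul,
      Matrix.vecMulVec_mul, Matrix.mul_vecMulVec, hWu, hvW, Matrix.one_mul, Matrix.mul_one]
  have hPt : Pᵀ = P := by
    rw [hP, Matrix.transpose_sub, Matrix.transpose_smul, Matrix.transpose_vecMulVec,
      Matrix.transpose_one]
  have hXsymm : X.Symm := hD.sub (hD.applyMat Q)
  have hXs : (Cb + X).fixMany s 1 = Ct.fixMany s 1 := by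
    rw [hX, Tensor.fixMany_add, Tensor.fixMany_sub, Tensor.applyMat_fixMany_one _ _ _ hQs,
      Tensor.fixMany_sub]
    abel
  have pythagoras : ∀ C : Tensor n (p + 1), C.Symm → C.fixMany s 1 = Ct.fixMany s 1 →
      ((C - Cb).applyMat W).frobNorm ^ 2 =
        (X.applyMat W).frobNorm ^ 2 + ((C - (Cb + X)).applyMat W).frobNorm ^ 2 := by
    intro C hC hCs
    set N := C - (Cb + X) with hN
    have hNsymm : N.Symm := hC.sub (hCb.add hXsymm)
    have hNs : N.fixMany s 1 = 0 := by rw [hN, Tensor.fixMany_sub, hCs, hXs, sub_self]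
    have hNP : (N.applyMat W).applyMat P = N.applyMat W := by
      rw [← Tensor.applyMat_mul, ← hQW, Tensor.applyMat_mul, hNsymm.applyMat_eq_self hNs]
    have horth : (X.applyMat W).finner (N.applyMat W) = 0 := by
      rw [hX, Tensor.applyMat_sub, ← Tensor.applyMat_mul _ Q W, hQW, Tensor.applyMat_mul,
        Tensor.finner_sub_left,
        Tensor.finner_applyMat_left ((Ct - Cb).applyMat W) _ P, hPt, hNP, sub_self]
    rw [← Tensor.frobNorm_add_sq _ _ horth, ← Tensor.applyMat_add]
    congr 3
    rw [hN]
    abel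
  refine ⟨⟨hCb.add hXsymm, hXs, fun C hC hCs => ?_⟩, fun Cp hCp => ?_⟩
  · rw [add_sub_cancel_left]
    refine le_of_sq_le_sq ?_ (Real.sqrt_nonneg _)
    rw [pythagoras C hC hCs]
    exact le_add_of_nonneg_right (sq_nonneg _)
  · obtain ⟨hsymm, hsec, hmin⟩ := hCp
    have hle := hmin (Cb + X) (hCb.add hXsymm) hXs
    rw [add_sub_cancel_left] at hle
    have hsq := pow_le_pow_left₀ (Real.sqrt_nonneg _) hle 2
    have hpy := pythagoras Cp hsymm hsec
    have h0 : ((Cp - (Cb + X)).applyMat W).frobNorm = 0 := by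
      refine pow_eq_zero_iff (two_ne_zero) |>.mp (le_antisymm ?_ (sq_nonneg _))
      simp only [Tensor.frobNorm] at hsq hpy ⊢
      linarith
    have hz := Tensor.eq_zero_of_frobNorm_eq_zero h0
    rw [← sub_eq_zero, ← Tensor.applyMat_one (Cp - (Cb + X)), ← hWW, Tensor.applyMat_mul, hz]
    ext j
    simp [Tensor.applyMat]
end
end

section
/- Let n ≥ 1, p ≥ 2, and let s ∈ ℝ^n be nonzero. Then the linear map φ from symmetric (p−1)-tensors on ℝ^n to symmetric (p−1)-tensors on ℝ^n defined by φ(A) = P_sym(A ⊗ s)[s] is bijective. -/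
open scoped BigOperators
open Matrix Filter

noncomputable section

namespace Tensor

theorem sum_insertNth {n q : ℕ} (l : Fin (q + 1)) (F : (Fin (q + 1) → Fin n) → ℝ) :
    ∑ i, F i = ∑ a, ∑ j : Fin q → Fin n, F (l.insertNth a j) := by
  rw [← (Fin.insertNthEquiv (fun _ => Fin n) l).sum_comp, Fintype.sum_prod_type]
  rfl

theorem sum_cons {n q : ℕ} (F : (Fin (q + 1) → Fin n) → ℝ) :
    ∑ i, F i = ∑ a, ∑ j : Fin q → Fin n, F (Fin.cons a j) := by
  simp_rw [sum_insertNth 0, Fin.insertNth_zero']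

/-- The symmetric tensors form a linear subspace. -/
def symmSubmodule (n q : ℕ) : Submodule ℝ (Tensor n q) where
  carrier := {A | A.Symm}
  add_mem' ha hb σ i := by simp only [Pi.add_apply, ha σ i, hb σ i]
  zero_mem' _ _ := rfl
  smul_mem' c A ha σ i := by simp only [Pi.smul_apply, ha σ i]

theorem psym_symm {n q : ℕ} (T : Tensor n q) : T.psym.Symm := by
  intro τ i
  simp only [psym, Function.comp_assoc]
  congr 1
  exact Fintype.sum_equiv (Equiv.mulLeft τ) (fun σ => T (i ∘ τ ∘ σ)) (fun σ => T (i ∘ σ))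
    fun σ => rfl

/-- The map `A ↦ P_sym(A ⊗ s)[s]`, in coordinates. -/
def symOuterContract {n q : ℕ} (s : Fin n → ℝ) : Tensor n q →ₗ[ℝ] Tensor n q where
  toFun A j := ∑ a, s a * (A.outer (vpow 1 s)).psym (Fin.cons a j)
  map_add' A B := by
    ext j
    simp only [psym, outer, Pi.add_apply, add_mul, mul_add, Finset.sum_add_distrib]
  map_smul' c A := by
    ext j
    simp only [psym, outer, Pi.smul_apply, smul_eq_mul, RingHom.id_apply, Finset.mul_sum]
    refine Finset.sum_congr rfl fun a _ => Finset.sum_congr rfl fun σ _ => ?_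
    ring

theorem fixMany_one_apply {n q : ℕ} (T : Tensor n (q + 1)) (s : Fin n → ℝ) (j : Fin q → Fin n) :
    T.fixMany s 1 j = ∑ a, s a * T (Fin.cons a j) := by
  unfold fixMany
  refine Fintype.sum_equiv (Equiv.funUnique (Fin 1) (Fin n)) _ _ fun i => ?_
  simp only [Fin.prod_univ_one, Equiv.funUnique_apply]
  congr 2
  funext k
  refine Fin.cases ?_ (fun l => ?_) k
  · simp
  · simp

theorem symOuterContract_symm {n q : ℕ} (s : Fin n → ℝ) (A : Tensor n q) :
    (symOuterContract s A).Symm := by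
  intro τ j
  simp only [symOuterContract, LinearMap.coe_mk, AddHom.coe_mk]
  refine Finset.sum_congr rfl fun a _ => ?_
  rw [← psym_symm _ (Equiv.Perm.decomposeFin.symm (0, τ)) (Fin.cons a j)]
  congr 2
  funext k
  refine Fin.cases ?_ (fun l => ?_) k
  · simp
  · simp

/-- A symmetric tensor only sees the set of positions from which its indices are read. -/
theorem Symm.comp_eq_of_range_eq {n q : ℕ} {α : Type*} {A : Tensor n q} (hA : A.Symm)
    (i : α → Fin n) {f g : Fin q → α} (hf : f.Injective) (hg : g.Injective)
    (h : Set.range f = Set.range g) : A (i ∘ f) = A (i ∘ g) := by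
  let τ : Equiv.Perm (Fin q) :=
    (Equiv.ofInjective f hf).trans ((Equiv.setCongr h).trans (Equiv.ofInjective g hg).symm)
  have hτ : f = g ∘ τ := by
    funext k
    simp [τ, Equiv.apply_ofInjective_symm]
  rw [hτ, ← Function.comp_assoc, hA τ]

theorem Symm.comp_perm_castSucc {n q : ℕ} {A : Tensor n q} (hA : A.Symm)
    (i : Fin (q + 1) → Fin n) (σ : Equiv.Perm (Fin (q + 1))) :
    A (i ∘ σ ∘ Fin.castSucc) = A (i ∘ (σ (Fin.last q)).succAbove) := by
  refine hA.comp_eq_of_range_eq i (σ.injective.comp (Fin.castSucc_injective q))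
    Fin.succAbove_right_injective ?_
  rw [Fin.range_succAbove, Set.range_comp, ← Fin.succAbove_last, Fin.range_succAbove,
    Set.image_compl_eq σ.bijective, Set.image_singleton]

theorem Symm.insertNth_eq_cons {n q : ℕ} {A : Tensor n (q + 1)} (hA : A.Symm)
    (l : Fin (q + 1)) (b : Fin n) (r : Fin q → Fin n) :
    A (l.insertNth b r) = A (Fin.cons b r) := by
  rw [← Fin.insertNth_zero', ← hA l.cycleRange.symm]
  congr 1
  funext k
  refine Fin.cases ?_ (fun m => ?_) k
  · simp
  · simp

/-- The pairing of `A ⊗ s`, with `s` in position `k`, against `s ⊗ A`. -/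
def outerPairing {n q : ℕ} (A : Tensor n q) (s : Fin n → ℝ) (k : Fin (q + 1)) : ℝ :=
  ∑ i : Fin (q + 1) → Fin n, s (i 0) * A (i ∘ Fin.succ) * (A (i ∘ k.succAbove) * s (i k))

theorem outerPairing_zero {n q : ℕ} (A : Tensor n q) (s : Fin n → ℝ) :
    A.outerPairing s 0 = (∑ a, s a ^ 2) * ∑ j, A j ^ 2 := by
  rw [outerPairing, sum_cons,
    Finset.sum_mul_sum]
  refine Finset.sum_congr rfl fun a _ => Finset.sum_congr rfl fun j _ => ?_
  have h : (Fin.cons a j : Fin (q + 1) → Fin n) ∘ Fin.succ = j := by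
    funext k; simp
  simp only [Fin.succAbove_zero, Fin.cons_zero, h]
  ring

theorem Symm.outerPairing_succ {n q : ℕ} {A : Tensor n (q + 1)} (hA : A.Symm) (s : Fin n → ℝ)
    (l : Fin (q + 1)) :
    A.outerPairing s l.succ = ∑ r : Fin q → Fin n, (∑ a, s a * A (Fin.cons a r)) ^ 2 := by
  rw [outerPairing, sum_cons]
  simp_rw [sum_insertNth l, sq, Finset.sum_mul_sum]
  rw [Finset.sum_comm]
  conv_rhs => rw [Finset.sum_comm]
  refine Finset.sum_congr rfl fun b _ => ?_
  conv_rhs => rw [Finset.sum_comm]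
  refine Finset.sum_congr rfl fun a _ => Finset.sum_congr rfl fun r _ => ?_
  have h₁ : (Fin.cons a (l.insertNth b r : Fin (q + 1) → Fin n) : Fin (q + 2) → Fin n) ∘ Fin.succ
      = l.insertNth b r := by
    funext k; simp
  have h₂ : (Fin.cons a (l.insertNth b r : Fin (q + 1) → Fin n) : Fin (q + 2) → Fin n) ∘
      l.succ.succAbove = Fin.cons a r := by
    funext k
    refine Fin.cases ?_ (fun m => ?_) k
    · simp
    · simp
  simp only [Fin.cons_zero, Fin.cons_succ,
    Fin.insertNth_apply_same, h₁, h₂, hA.insertNth_eq_cons]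
  ring

theorem Symm.outerPairing_nonneg {n q : ℕ} {A : Tensor n q} (hA : A.Symm) (s : Fin n → ℝ)
    (k : Fin (q + 1)) : 0 ≤ A.outerPairing s k := by
  refine Fin.cases ?_ (fun l => ?_) k
  · rw [outerPairing_zero]
    positivity
  · cases q with
    | zero => exact l.elim0
    | succ m =>
      rw [hA.outerPairing_succ]
      positivity

theorem Symm.finner_symOuterContract {n q : ℕ} {A : Tensor n q} (hA : A.Symm)
    (s : Fin n → ℝ) :
    A.finner (symOuterContract s A) = ((q + 1).factorial : ℝ)⁻¹ *
      ∑ σ : Equiv.Perm (Fin (q + 1)), A.outerPairing s (σ (Fin.last q)) := by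
  simp only [outerPairing]
  rw [Finset.sum_comm, sum_cons,
    Finset.sum_comm, Finset.mul_sum]
  refine Finset.sum_congr rfl fun j _ => ?_
  simp only [symOuterContract, LinearMap.coe_mk, AddHom.coe_mk, Finset.mul_sum]
  refine Finset.sum_congr rfl fun a _ => ?_
  have h : (Fin.cons a j : Fin (q + 1) → Fin n) ∘ Fin.succ = j := by
    funext k; simp
  simp only [psym, Finset.mul_sum]
  refine Finset.sum_congr rfl fun σ _ => ?_
  have h₂ : (A.outer (vpow 1 s)) ((Fin.cons a j : Fin (q + 1) → Fin n) ∘ σ) =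
      A ((Fin.cons a j : Fin (q + 1) → Fin n) ∘ (σ (Fin.last q)).succAbove) *
        s ((Fin.cons a j : Fin (q + 1) → Fin n) (σ (Fin.last q))) := by
    rw [← hA.comp_perm_castSucc]
    simp only [outer, vpow, Fin.prod_univ_one]
    rfl
  simp only [h₂, Fin.cons_zero, h]
  ring

theorem Symm.eq_zero_of_symOuterContract_eq_zero {n q : ℕ} {A : Tensor n q} (hA : A.Symm)
    {s : Fin n → ℝ} (hs : s ≠ 0) (h : symOuterContract s A = 0) : A = 0 := by
  by_contra hne
  obtain ⟨a, ha⟩ := Function.ne_iff.mp hs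
  obtain ⟨j, hj⟩ := Function.ne_iff.mp hne
  have hs2 : 0 < ∑ a, s a ^ 2 :=
    Finset.sum_pos' (fun _ _ => sq_nonneg _) ⟨a, Finset.mem_univ a, sq_pos_of_ne_zero ha⟩
  have hA2 : 0 < ∑ j, A j ^ 2 :=
    Finset.sum_pos' (fun _ _ => sq_nonneg _) ⟨j, Finset.mem_univ j, sq_pos_of_ne_zero hj⟩
  have hpos : 0 < ∑ σ : Equiv.Perm (Fin (q + 1)), A.outerPairing s (σ (Fin.last q)) := by
    refine Finset.sum_pos' (fun σ _ => hA.outerPairing_nonneg s _)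
      ⟨Equiv.swap (Fin.last q) 0, Finset.mem_univ _, ?_⟩
    rw [Equiv.swap_apply_left, outerPairing_zero]
    exact mul_pos hs2 hA2
  have hform := hA.finner_symOuterContract s
  rw [h] at hform
  have hzero : A.finner 0 = 0 := by simp [finner]
  have : 0 < ((q + 1).factorial : ℝ)⁻¹ *
      ∑ σ : Equiv.Perm (Fin (q + 1)), A.outerPairing s (σ (Fin.last q)) := by positivity
  linarith

theorem bijOn_symOuterContract {n q : ℕ} {s : Fin n → ℝ} (hs : s ≠ 0) :
    Set.BijOn (symOuterContract s) {A : Tensor n q | A.Symm} {B : Tensor n q | B.Symm} := by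
  let L : symmSubmodule n q →ₗ[ℝ] symmSubmodule n q :=
    (symOuterContract s).restrict fun A _ => symOuterContract_symm s A
  have hinj : Function.Injective L := by
    rw [injective_iff_map_eq_zero]
    intro A hA
    exact Subtype.ext (A.2.eq_zero_of_symOuterContract_eq_zero hs (congrArg Subtype.val hA))
  refine ⟨fun A _ => symOuterContract_symm s A, fun A hA B hB h => ?_, fun B hB => ?_⟩
  · exact congrArg Subtype.val (@hinj ⟨A, hA⟩ ⟨B, hB⟩ (Subtype.ext h))
  · obtain ⟨A, hA⟩ := LinearMap.injective_iff_surjective.mp hinj ⟨B, hB⟩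
    exact ⟨A, A.2, congrArg Subtype.val hA⟩

end Tensor

/-- the map `A ↦ P_sym(A ⊗ s)[s]` is a bijection from symmetric
`(p-1)`-tensors to symmetric `(p-1)`-tensors. -/
theorem statement6 (n p : ℕ) (hn : 1 ≤ n) (hp : 2 ≤ p)
    (s : Fin n → ℝ) (hs : s ≠ 0) :
    Set.BijOn
      (fun A : Tensor n (p - 1) =>
        (Tensor.castOrder (by omega : p - 1 + 1 = p)
          (Tensor.psym (A.outer (vpow 1 s)))).fixMany s 1)
      {A : Tensor n (p - 1) | A.Symm} {B : Tensor n (p - 1) | B.Symm} := by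
  obtain ⟨q, rfl⟩ : ∃ q, p = q + 1 := ⟨p - 1, by omega⟩
  refine (Tensor.bijOn_symOuterContract (q := q) hs).congr fun A _ => ?_
  funext j
  exact (Tensor.fixMany_one_apply _ s j).symm
end
end

section
/- Let (W_k) be a sequence of nonsingular matrices in ℝ^{n×n} converging to the identity matrix I, and let (s_k) be any sequence of nonzero vectors in ℝ^n. Define P_k = I − (W_k^{-1}s_k s_k^T W_k^{-T})/(s_k^T W_k^{-T} W_k^{-1} s_k), P_k' = W_k P_k W_k^{-1}, and P_k^* = I − (s_k s_k^T)/(s_k^T s_k). Then ‖P_k' − P_k^*‖_2 → 0 as k → ∞. -/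
open scoped BigOperators
open Matrix Filter

noncomputable section

theorem continuous_specNorm {n : ℕ} :
    Continuous (specNorm : Matrix (Fin n) (Fin n) ℝ → ℝ) :=
  (LinearMap.continuous_of_finiteDimensional
    (Matrix.toEuclideanCLM (n := Fin n) (𝕜 := ℝ)).toAlgEquiv.toLinearMap).norm

theorem specNorm_zero {n : ℕ} : specNorm (0 : Matrix (Fin n) (Fin n) ℝ) = 0 := by
  simp [specNorm]

theorem specNorm_nonneg {n : ℕ} (M : Matrix (Fin n) (Fin n) ℝ) : 0 ≤ specNorm M :=
  norm_nonneg _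

/-- The projection onto `wᗮ` depends only on the line spanned by `w`. -/
theorem projPerp_smul {n : ℕ} {c : ℝ} (hc : c ≠ 0) (w : Fin n → ℝ) :
    projPerp (c • w) = projPerp w := by
  simp only [projPerp, smul_dotProduct, dotProduct_smul, smul_vecMulVec, vecMulVec_smul,
    smul_smul, smul_eq_mul]
  congr 2
  rw [mul_inv, mul_inv]
  field_simp

theorem continuousAt_projPerp {n : ℕ} {w : Fin n → ℝ} (hw : w ≠ 0) :
    ContinuousAt projPerp w := by
  have hne : w ⬝ᵥ w ≠ 0 := fun h => hw (dotProduct_self_eq_zero.mp h)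
  have hdot : Continuous fun v : Fin n → ℝ => v ⬝ᵥ v := continuous_id.dotProduct continuous_id
  have houter : Continuous fun v : Fin n → ℝ => vecMulVec v v :=
    continuous_id.matrix_vecMulVec continuous_id
  exact continuousAt_const.sub ((hdot.continuousAt.inv₀ hne).smul houter.continuousAt)

/-- The discrepancy between the conjugated projection `A P A⁻¹` and the orthogonal projection,
as a function of the matrix `A` and the vector `u`, is continuous at every `(1, u)`, `u ≠ 0`. -/
theorem continuousAt_conj_projPerp_sub {n : ℕ} {u : Fin n → ℝ} (hu : u ≠ 0) :
    ContinuousAt (fun z : Matrix (Fin n) (Fin n) ℝ × (Fin n → ℝ) =>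
      z.1 * projPerp (z.1⁻¹ *ᵥ z.2) * z.1⁻¹ - projPerp z.2) (1, u) := by
  have hinv : ContinuousAt (fun z : Matrix (Fin n) (Fin n) ℝ × (Fin n → ℝ) => z.1⁻¹) (1, u) := by
    refine ContinuousAt.comp (g := fun A : Matrix (Fin n) (Fin n) ℝ => A⁻¹)
      (continuousAt_matrix_inv _ ?_) continuousAt_fst
    simp
  have hmulVec : ContinuousAt
      (fun z : Matrix (Fin n) (Fin n) ℝ × (Fin n → ℝ) => z.1⁻¹ *ᵥ z.2) (1, u) :=
    (continuous_fst.matrix_mulVec continuous_snd).continuousAt.comp (hinv.prodMk continuousAt_snd)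
  have hproj : ContinuousAt
      (fun z : Matrix (Fin n) (Fin n) ℝ × (Fin n → ℝ) => projPerp (z.1⁻¹ *ᵥ z.2)) (1, u) :=
    ContinuousAt.comp (g := projPerp) (continuousAt_projPerp (by simpa using hu)) hmulVec
  exact ((continuousAt_fst.mul hproj).mul hinv).sub
    (ContinuousAt.comp (g := projPerp) (continuousAt_projPerp hu) continuousAt_snd)

/-- if `W_k → I`, then `‖P_k' - P_k^*‖₂ → 0`, where `P_k' = W_k P_k W_k⁻¹`. -/
theorem statement12 (n : ℕ)
    (W : ℕ → Matrix (Fin n) (Fin n) ℝ) (hW : ∀ k, IsUnit (W k).det)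
    (hWlim : Tendsto W atTop (nhds 1))
    (s : ℕ → (Fin n → ℝ)) (hs : ∀ k, s k ≠ 0) :
    Tendsto
      (fun k => specNorm (W k * projPerp ((W k)⁻¹ *ᵥ s k) * (W k)⁻¹ - projPerp (s k)))
      atTop (nhds 0) := by
  refine tendsto_order.mpr ⟨fun a ha => Eventually.of_forall fun k =>
    ha.trans_le (specNorm_nonneg _), fun ε hε => ?_⟩
  have hunif : ∀ᶠ A : Matrix (Fin n) (Fin n) ℝ in nhds 1,
      ∀ u ∈ Metric.sphere (0 : Fin n → ℝ) 1,
        specNorm (A * projPerp (A⁻¹ *ᵥ u) * A⁻¹ - projPerp u) < ε := by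
    refine (isCompact_sphere _ _).eventually_forall_of_forall_eventually fun u hu => ?_
    have hu0 : u ≠ 0 := ne_zero_of_mem_unit_sphere ⟨u, hu⟩
    refine (continuous_specNorm.continuousAt.comp
      (continuousAt_conj_projPerp_sub hu0)).eventually_lt_const ?_
    simpa [specNorm_zero] using hε
  filter_upwards [hWlim.eventually hunif] with k hk
  have hnorm : ‖s k‖ ≠ 0 := norm_ne_zero_iff.mpr (hs k)
  have hlt := hk (‖s k‖⁻¹ • s k) (by simp [norm_smul, hnorm])
  rwa [mulVec_smul, projPerp_smul (inv_ne_zero hnorm), projPerp_smul (inv_ne_zero hnorm)] at hlt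
end
end
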